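/- arXiv:math/9404222 — 4 statements merged into one kernel-verified Lean document; each statement's English description precedes it below -/
import Mathlib

section
/- Let f : ℝ → ℝ be smooth, let q ∈ ℕ with q ≥ 2, and define h : ℝ → ℝ by h(x) = f(x^{1/q}). Then for every s ∈ ℕ with s ≥ 1 there exist real constants C_s, C_{s+1}, …, C_{sq} with C_{sq} = q^{sq}, such that for every x > 0: f^{(sq)}(x^{1/q}) = ∑_{k=s}^{sq} C_k·x^{k−s}·h^{(k)}(x). -/
open Real Finset

/-- The coefficient of `t ^ (q * k - n) * h⁽ᵏ⁾ (t ^ q)` in the `n`-th derivative of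
`t ↦ h (t ^ q)`. -/
def powCompCoeff (q : ℕ) : ℕ → ℕ → ℝ
  | 0, 0 => 1
  | 0, _ + 1 => 0
  | n + 1, 0 => -n * powCompCoeff q n 0
  | n + 1, k + 1 =>
    (q * (k + 1) - n) * powCompCoeff q n (k + 1) + q * powCompCoeff q n k

theorem powCompCoeff_eq_zero_of_lt (q : ℕ) {n k : ℕ} (hk : n < k) : powCompCoeff q n k = 0 := by
  induction n generalizing k with
  | zero => obtain _ | k := k <;> simp_all [powCompCoeff]
  | succ n ih =>
    obtain _ | k := k
    · omega
    · simp [powCompCoeff, ih (show n < k + 1 by omega), ih (show n < k by omega)]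

theorem powCompCoeff_self (q n : ℕ) : powCompCoeff q n n = (q : ℝ) ^ n := by
  induction n with
  | zero => simp [powCompCoeff]
  | succ n ih =>
    rw [powCompCoeff, powCompCoeff_eq_zero_of_lt q (Nat.lt_succ_self n), ih]
    ring

theorem powCompCoeff_eq_zero_of_mul_lt {q : ℕ} (hq : 0 < q) {n k : ℕ} (hk : q * k < n) :
    powCompCoeff q n k = 0 := by
  induction n generalizing k with
  | zero => omega
  | succ n ih =>
    obtain _ | k := k
    · obtain _ | n := n
      · simp [powCompCoeff]
      · rw [powCompCoeff, ih (show q * 0 < n + 1 by omega), mul_zero]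
    · have hlt : q * k < n := by rw [mul_add] at hk; omega
      rw [powCompCoeff, ih hlt]
      rcases (Nat.lt_succ_iff.mp hk).lt_or_eq with h | h
      · simp [ih h]
      · simp [← h]

theorem ContDiffAt.differentiableAt_iteratedDeriv {𝕜 F : Type*} [NontriviallyNormedField 𝕜]
    [NormedAddCommGroup F] [NormedSpace 𝕜 F] {f : 𝕜 → F} {x : 𝕜} {n : WithTop ℕ∞} {k : ℕ}
    (hf : ContDiffAt 𝕜 n f x) (hk : k < n) : DifferentiableAt 𝕜 (iteratedDeriv k f) x := by
  rw [iteratedDeriv_eq_equiv_comp, LinearIsometryEquiv.comp_differentiableAt_iff]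
  exact hf.differentiableAt_iteratedFDeriv hk

theorem iteratedDeriv_eq_sum_powCompCoeff {f h : ℝ → ℝ} {q : ℕ}
    (hh : ∀ x : ℝ, 0 < x → ContDiffAt ℝ (⊤ : ℕ∞) h x) (hfh : ∀ t : ℝ, 0 < t → f t = h (t ^ q))
    (n : ℕ) {t : ℝ} (ht : 0 < t) :
    iteratedDeriv n f t = ∑ k ∈ range (n + 1),
      powCompCoeff q n k * t ^ ((q : ℤ) * k - n) * iteratedDeriv k h (t ^ q) := by
  induction n generalizing t with
  | zero => simp [powCompCoeff, hfh t ht]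
  | succ n ih =>
    have hev : iteratedDeriv n f =ᶠ[nhds t] fun u ↦ ∑ k ∈ range (n + 1),
        powCompCoeff q n k * u ^ ((q : ℤ) * k - n) * iteratedDeriv k h (u ^ q) := by
      filter_upwards [lt_mem_nhds ht] with u hu using ih hu
    have hder (k : ℕ) : HasDerivAt (iteratedDeriv k h) (iteratedDeriv (k + 1) h (t ^ q))
        (t ^ q) := by
      rw [iteratedDeriv_succ]
      exact ((hh _ (pow_pos ht q)).differentiableAt_iteratedDeriv
        (WithTop.coe_lt_coe.mpr (ENat.natCast_lt_top k))).hasDerivAt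
    have hterm (k : ℕ) : HasDerivAt
        (fun u ↦ powCompCoeff q n k * u ^ ((q : ℤ) * k - n) * iteratedDeriv k h (u ^ q))
        (powCompCoeff q n k * ((((q : ℤ) * k - n : ℤ) : ℝ) * t ^ ((q : ℤ) * k - n - 1)) *
            iteratedDeriv k h (t ^ q) +
          powCompCoeff q n k * t ^ ((q : ℤ) * k - n) *
            (iteratedDeriv (k + 1) h (t ^ q) * (q * t ^ (q - 1)))) t :=
      ((hasDerivAt_zpow ((q : ℤ) * k - n) t (Or.inl ht.ne')).const_mul
      (powCompCoeff q n k)).mul ((hder k).comp t (hasDerivAt_pow q t))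
    have hsum := HasDerivAt.fun_sum (u := range (n + 1)) fun k _ ↦ hterm k
    rw [iteratedDeriv_succ, (hsum.congr_of_eventuallyEq hev).deriv, sum_add_distrib,
      sum_range_succ' _ (n + 1)]
    have hfirst : ∑ k ∈ range (n + 1), powCompCoeff q n k *
          ((((q : ℤ) * k - n : ℤ) : ℝ) * t ^ ((q : ℤ) * k - n - 1)) * iteratedDeriv k h (t ^ q) =
        ∑ k ∈ range (n + 2), powCompCoeff q n k *
          ((((q : ℤ) * k - n : ℤ) : ℝ) * t ^ ((q : ℤ) * k - n - 1)) *
            iteratedDeriv k h (t ^ q) := by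
      rw [sum_range_succ _ (n + 1), powCompCoeff_eq_zero_of_lt q (Nat.lt_succ_self n)]
      simp
    have hexp (k : ℕ) : (q : ℝ) * t ^ ((q : ℤ) * (k + 1 : ℕ) - n - 1) =
        t ^ ((q : ℤ) * k - n) * (q * t ^ (q - 1)) := by
      obtain _ | q := q
      · simp
      · rw [Nat.add_sub_cancel, ← zpow_natCast t q, mul_left_comm, ← zpow_add₀ ht.ne']
        congr 2
        push_cast
        ring
    rw [hfirst, sum_range_succ' _ (n + 1), add_right_comm, ← sum_add_distrib]
    congr 1
    · refine sum_congr rfl fun k _ ↦ ?_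
      rw [powCompCoeff, Nat.cast_succ n, ← sub_sub]
      push_cast at hexp ⊢
      linear_combination (-powCompCoeff q n k * iteratedDeriv (k + 1) h (t ^ q)) * hexp k
    · rw [powCompCoeff, Nat.cast_succ n, ← sub_sub]
      push_cast
      ring

theorem lemma_1q_b_part1 (f : ℝ → ℝ) (hf : ContDiff ℝ (⊤ : ℕ∞) f) (q : ℕ) (hq : 2 ≤ q)
    (h : ℝ → ℝ) (hh : ∀ x : ℝ, h x = f (x ^ (1 / (q : ℝ)))) :
    ∀ s : ℕ, 1 ≤ s →
      ∃ C : ℕ → ℝ, C (s * q) = (q : ℝ) ^ (s * q) ∧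
        ∀ x : ℝ, 0 < x →
          iteratedDeriv (s * q) f (x ^ (1 / (q : ℝ))) =
            ∑ k ∈ Finset.Icc s (s * q), C k * x ^ (k - s) * iteratedDeriv k h x := by
  intro s _
  have hq0 : q ≠ 0 := by omega
  refine ⟨powCompCoeff q (s * q), powCompCoeff_self q _, fun x hx ↦ ?_⟩
  have hsmooth (y : ℝ) (hy : 0 < y) : ContDiffAt ℝ (⊤ : ℕ∞) h y := by
    rw [funext hh]
    exact hf.contDiffAt.comp y (contDiffAt_id.rpow_const_of_ne hy.ne')
  have hfh (t : ℝ) (ht : 0 < t) : f t = h (t ^ q) := by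
    rw [hh, one_div, pow_rpow_inv_natCast ht.le hq0]
  have hroot : (x ^ (1 / (q : ℝ))) ^ q = x := by
    rw [one_div, rpow_inv_natCast_pow hx.le hq0]
  have ht : 0 < x ^ (1 / (q : ℝ)) := rpow_pos_of_pos hx _
  rw [iteratedDeriv_eq_sum_powCompCoeff hsmooth hfh _ ht, hroot]
  symm
  apply sum_subset_zero_on_sdiff
  · intro k hk
    simp only [mem_Icc, mem_range] at hk ⊢
    omega
  · intro k hk
    simp only [mem_sdiff, mem_Icc, mem_range] at hk
    have hks : k < s := by omega
    rw [powCompCoeff_eq_zero_of_mul_lt (by omega)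
      (by rw [mul_comm s]; exact Nat.mul_lt_mul_of_pos_left hks (by omega))]
    simp
  · intro k hk
    obtain ⟨j, rfl⟩ := Nat.exists_eq_add_of_le (mem_Icc.mp hk).1
    rw [show (q : ℤ) * (s + j : ℕ) - (s * q : ℕ) = (q * j : ℕ) by push_cast; ring,
      zpow_natCast, pow_mul, hroot, Nat.add_sub_cancel_left]
end

section
/- Let f : ℝ → ℝ be smooth, let q ∈ ℕ with q ≥ 2, and define h : ℝ → ℝ by h(x) = f(x^{1/q}). Then for all s, r ∈ ℕ with s ≥ 1 and 1 ≤ r ≤ q−1 there exist real constants C_{s+1}, C_{s+2}, …, C_{sq+r} with C_{sq+r} = q^{sq+r}, such that for every x > 0: x^{r/q}·f^{(sq+r)}(x^{1/q}) = ∑_{k=s+1}^{sq+r} C_k·x^{k−s}·h^{(k)}(x). -/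
open Real Finset

/-- The coefficients of `∏ j < m, (q θ - j)` in the basis of falling factorials of the Euler
operator `θ = x d/dx`. -/
def eulerCoeff (q : ℕ) : ℕ → ℕ → ℝ
  | 0, 0 => 1
  | 0, _ + 1 => 0
  | m + 1, 0 => -(m : ℝ) * eulerCoeff q m 0
  | m + 1, k + 1 => q * eulerCoeff q m k + (q * (k + 1) - m) * eulerCoeff q m (k + 1)

theorem eulerCoeff_eq_zero_of_lt (q : ℕ) {m k : ℕ} (h : m < k) : eulerCoeff q m k = 0 := by
  induction m generalizing k with
  | zero => obtain ⟨k, rfl⟩ := Nat.exists_eq_succ_of_ne_zero h.ne'; simp [eulerCoeff]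
  | succ m ih =>
    obtain ⟨k, rfl⟩ := Nat.exists_eq_succ_of_ne_zero (Nat.ne_zero_of_lt h)
    simp [eulerCoeff, ih (show m < k by omega), ih (show m < k + 1 by omega)]

theorem eulerCoeff_self (q m : ℕ) : eulerCoeff q m m = (q : ℝ) ^ m := by
  induction m with
  | zero => simp [eulerCoeff]
  | succ m ih => simp [eulerCoeff, ih, eulerCoeff_eq_zero_of_lt q (Nat.lt_succ_self m), pow_succ']

theorem eulerCoeff_eq_zero_of_mul_lt (q : ℕ) {m k : ℕ} (h : k * q < m) :
    eulerCoeff q m k = 0 := by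
  induction m generalizing k with
  | zero => omega
  | succ m ih =>
    cases k with
    | zero =>
      rcases Nat.eq_zero_or_pos m with rfl | hm
      · simp [eulerCoeff]
      · simp [eulerCoeff, ih (k := 0) (by omega)]
    | succ k =>
      have hk : (k + 1) * q = k * q + q := by ring
      rcases Nat.eq_zero_or_pos q with rfl | hq
      · rcases Nat.eq_zero_or_pos m with rfl | hm
        · simp [eulerCoeff]
        · simp [eulerCoeff, ih (k := k + 1) (by omega)]
      · rw [eulerCoeff, ih (k := k) (by omega)]
        rcases (Nat.lt_succ_iff.mp h).lt_or_eq with hlt | heq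
        · simp [ih hlt]
        · have : (q : ℝ) * (k + 1) - m = 0 := by rw [← heq]; push_cast; ring
          simp [this]

theorem sum_eulerCoeff_succ (q m : ℕ) (u : ℕ → ℝ) :
    ∑ k ∈ range (m + 2), eulerCoeff q (m + 1) k * u k =
      ∑ k ∈ range (m + 1), eulerCoeff q m k * (q * (k * u k + u (k + 1)) - m * u k) := by
  have h₁ : ∑ k ∈ range (m + 1), eulerCoeff q m k * ((q * k - m) * u k) =
      ∑ k ∈ range (m + 2), eulerCoeff q m k * ((q * k - m) * u k) := by
    rw [sum_range_succ _ (m + 1), eulerCoeff_eq_zero_of_lt q (Nat.lt_succ_self m)]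
    simp
  have h₂ : ∀ k : ℕ, eulerCoeff q m k * (q * (k * u k + u (k + 1)) - m * u k) =
      eulerCoeff q m k * ((q * k - m) * u k) + q * eulerCoeff q m k * u (k + 1) := by
    intro k; ring
  simp_rw [h₂]
  rw [sum_add_distrib, h₁, sum_range_succ' _ (m + 1), sum_range_succ' _ (m + 1), add_right_comm,
    ← sum_add_distrib]
  congr 1
  · refine sum_congr rfl fun k _ => ?_
    rw [eulerCoeff]
    push_cast
    ring
  · simp only [eulerCoeff]
    push_cast
    ring

theorem hasDerivAt_iteratedDeriv {h : ℝ → ℝ} {x : ℝ} (hx : ContDiffAt ℝ (⊤ : ℕ∞) h x) (k : ℕ) :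
    HasDerivAt (iteratedDeriv k h) (iteratedDeriv (k + 1) h x) x := by
  have hk : DifferentiableAt ℝ (iteratedFDeriv ℝ k h) x :=
    hx.differentiableAt_iteratedFDeriv (by exact_mod_cast ENat.natCast_lt_top k)
  rw [iteratedDeriv_succ, iteratedDeriv_eq_equiv_comp]
  exact ((ContinuousMultilinearMap.piFieldEquiv ℝ (Fin k) ℝ).symm.differentiableAt.comp x
    hk).hasDerivAt

theorem pow_mul_iteratedDeriv_rpow_inv {f : ℝ → ℝ} (hf : ContDiff ℝ (⊤ : ℕ∞) f) {q : ℕ}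
    (hq : q ≠ 0) (m : ℕ) {x : ℝ} (hx : 0 < x) :
    (x ^ (1 / (q : ℝ))) ^ m * iteratedDeriv m f (x ^ (1 / (q : ℝ))) =
      ∑ k ∈ range (m + 1),
        eulerCoeff q m k * (x ^ k * iteratedDeriv k (fun y => f (y ^ (1 / (q : ℝ)))) x) := by
  induction m generalizing x with
  | zero => simp [eulerCoeff]
  | succ m ih =>
    have hq' : (q : ℝ) ≠ 0 := Nat.cast_ne_zero.mpr hq
    set h : ℝ → ℝ := fun y => f (y ^ (1 / (q : ℝ)))
    set t := x ^ (1 / (q : ℝ)) with ht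
    have hsm : ContDiffAt ℝ (⊤ : ℕ∞) h x :=
      hf.contDiffAt.comp x (Real.contDiffAt_rpow_const_of_ne hx.ne')
    have hroot : HasDerivAt (fun y : ℝ => y ^ (1 / (q : ℝ))) (t / (q * x)) x := by
      convert Real.hasDerivAt_rpow_const (p := 1 / (q : ℝ)) (Or.inl hx.ne') using 1
      rw [Real.rpow_sub_one hx.ne', ← ht]
      field_simp
    have hL := ((hasDerivAt_pow m t).mul (hasDerivAt_iteratedDeriv hf.contDiffAt m)).comp x hroot
    have hR : HasDerivAt
        (fun y => ∑ k ∈ range (m + 1), eulerCoeff q m k * (y ^ k * iteratedDeriv k h y))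
        (∑ k ∈ range (m + 1), eulerCoeff q m k *
          (k * x ^ (k - 1) * iteratedDeriv k h x + x ^ k * iteratedDeriv (k + 1) h x)) x :=
      HasDerivAt.fun_sum fun k _ =>
        ((hasDerivAt_pow k x).mul (hasDerivAt_iteratedDeriv hsm k)).const_mul _
    have hev := (eventually_gt_nhds hx).mono fun y hy => ih hy
    have hpow : ∀ (k : ℕ) (y : ℝ), (k : ℝ) * y ^ (k - 1) * y = k * y ^ k := by
      intro k y
      cases k with
      | zero => simp
      | succ k => simp [pow_succ, mul_assoc]
    have hderiv := hL.unique (hR.congr_of_eventuallyEq hev)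
    have hscaled := congrArg (fun z => q * x * z) hderiv
    have hleft : q * x * ((m * t ^ (m - 1) * iteratedDeriv m f t +
        t ^ m * iteratedDeriv (m + 1) f t) * (t / (q * x))) =
        m * (t ^ m * iteratedDeriv m f t) + t ^ (m + 1) * iteratedDeriv (m + 1) f t := by
      have := hpow m t
      field_simp
      linear_combination iteratedDeriv m f t * this
    have hm := ih hx
    rw [sum_eulerCoeff_succ q m fun k => x ^ k * iteratedDeriv k h x]
    simp_rw [mul_sub, sum_sub_distrib]
    have hright : q * x * ∑ k ∈ range (m + 1), eulerCoeff q m k *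
          (k * x ^ (k - 1) * iteratedDeriv k h x + x ^ k * iteratedDeriv (k + 1) h x) =
        ∑ k ∈ range (m + 1), eulerCoeff q m k * (q * (k * (x ^ k * iteratedDeriv k h x) +
          x ^ (k + 1) * iteratedDeriv (k + 1) h x)) := by
      rw [mul_sum]
      refine sum_congr rfl fun k _ => ?_
      linear_combination eulerCoeff q m k * q * iteratedDeriv k h x * hpow k x
    have hsub : ∑ k ∈ range (m + 1), eulerCoeff q m k * (m * (x ^ k * iteratedDeriv k h x)) =
        m * ∑ k ∈ range (m + 1), eulerCoeff q m k * (x ^ k * iteratedDeriv k h x) := by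
      rw [mul_sum]
      exact sum_congr rfl fun k _ => by ring
    rw [hsub, ← hright, ← hm]
    have := hleft.symm.trans hscaled
    linear_combination this

theorem lemma_1q_b_part2 (f : ℝ → ℝ) (hf : ContDiff ℝ (⊤ : ℕ∞) f) (q : ℕ) (hq : 2 ≤ q)
    (h : ℝ → ℝ) (hh : ∀ x : ℝ, h x = f (x ^ (1 / (q : ℝ)))) :
    ∀ s r : ℕ, 1 ≤ s → 1 ≤ r → r ≤ q - 1 →
      ∃ C : ℕ → ℝ, C (s * q + r) = (q : ℝ) ^ (s * q + r) ∧
        ∀ x : ℝ, 0 < x →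
          x ^ ((r : ℝ) / q) * iteratedDeriv (s * q + r) f (x ^ (1 / (q : ℝ))) =
            ∑ k ∈ Finset.Icc (s + 1) (s * q + r), C k * x ^ (k - s) * iteratedDeriv k h x := by
  intro s r _ hr _
  refine ⟨eulerCoeff q (s * q + r), eulerCoeff_self q _, fun x hx => ?_⟩
  have hq₀ : q ≠ 0 := by omega
  have hq' : (q : ℝ) ≠ 0 := Nat.cast_ne_zero.mpr hq₀
  have key := pow_mul_iteratedDeriv_rpow_inv hf hq₀ (s * q + r) hx
  rw [← funext hh] at key
  have hroot : (x ^ (1 / (q : ℝ))) ^ (s * q + r) = x ^ s * x ^ ((r : ℝ) / q) := by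
    rw [← Real.rpow_natCast, ← Real.rpow_mul hx.le, ← Real.rpow_natCast x s, ← Real.rpow_add hx]
    congr 1
    push_cast
    field_simp
  refine mul_left_cancel₀ (pow_pos hx s).ne' ?_
  rw [← mul_assoc, ← hroot, key, mul_sum]
  have hsubset : Icc (s + 1) (s * q + r) ⊆ range (s * q + r + 1) := fun k hk => by
    simp only [mem_Icc, mem_range] at *
    omega
  rw [← sum_subset hsubset]
  · refine sum_congr rfl fun k hk => ?_
    rw [← pow_mul_pow_sub x (show s ≤ k by have := (mem_Icc.mp hk).1; omega)]
    ring
  · intro k hk hk'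
    simp only [mem_Icc, mem_range] at hk hk'
    have : k * q ≤ s * q := Nat.mul_le_mul_right q (by omega)
    rw [eulerCoeff_eq_zero_of_mul_lt q (by omega), zero_mul]
end

section
/- Let f : ℝ → ℝ be smooth and suppose f satisfies a simple differential equation of order ≤ n on (0,∞) with n ≥ 1, and let q ∈ ℕ with q ≥ 1. Then the function h : ℝ → ℝ defined by h(x) = f(x^{1/q}) satisfies a simple differential equation of order ≤ n·q on (0,∞). -/
open Real Finset

/-- `f` satisfies a simple differential equation of order ≤ `n` on `S`. -/
def SimpleDE (f : ℝ → ℝ) (n : ℕ) (S : Set ℝ) : Prop :=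
  ∃ p : ℕ → Polynomial ℝ, (∃ k ≤ n, p k ≠ 0) ∧
    ∀ x ∈ S, ∑ k ∈ Finset.range (n + 1), (p k).eval x * iteratedDeriv k f x = 0

open Polynomial in
/-- Every polynomial splits according to the residues modulo `q` of its exponents. -/
theorem exists_sum_expand_mul_X_pow {R : Type*} [CommRing R] {q : ℕ} (hq : 0 < q) (P : R[X]) :
    ∃ u : Fin q → R[X], P = ∑ r, expand R q (u r) * X ^ (r : ℕ) := by
  induction P using Polynomial.induction_on' with
  | add P Q hP hQ =>
    obtain ⟨u, hu⟩ := hP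
    obtain ⟨w, hw⟩ := hQ
    refine ⟨u + w, ?_⟩
    conv_lhs => rw [hu, hw]
    simp [add_mul, Finset.sum_add_distrib]
  | monomial k a =>
    refine ⟨Pi.single ⟨k % q, Nat.mod_lt k hq⟩ (C a * X ^ (k / q)), ?_⟩
    rw [Finset.sum_eq_single ⟨k % q, Nat.mod_lt k hq⟩]
    · simp [← C_mul_X_pow_eq_monomial, mul_assoc, ← pow_mul, ← pow_add, Nat.div_add_mod]
    · intro r _ hr
      simp [hr]
    · simp

open Polynomial in
/-- More than `m * q` vectors of `R[X] ^ m` are linearly dependent over `R[X ^ q]`. -/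
theorem exists_sum_expand_mul_eq_zero {R : Type*} [CommRing R] [Nontrivial R] (m : ℕ) {q : ℕ}
    (hq : 0 < q) (v : Fin (m * q + 1) → Fin m → R[X]) :
    ∃ c : Fin (m * q + 1) → R[X], (∃ j, c j ≠ 0) ∧
      ∀ i, ∑ j, expand R q (c j) * v j i = 0 := by
  choose u hu using fun j i => exists_sum_expand_mul_X_pow hq (v j i)
  have hdep : ¬ LinearIndependent R[X] fun j (x : Fin m × Fin q) => u j x.1 x.2 := by
    intro hli
    have := hli.fintype_card_le_finrank
    simp at this
  obtain ⟨c, hc, j, hj⟩ := Fintype.not_linearIndependent_iff.1 hdep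
  refine ⟨c, ⟨j, hj⟩, fun i => ?_⟩
  calc ∑ j, expand R q (c j) * v j i
      = ∑ j, ∑ r, expand R q (c j * u j i r) * X ^ (r : ℕ) := by
        refine Finset.sum_congr rfl fun j _ => ?_
        rw [hu j i, Finset.mul_sum]
        simp [mul_assoc]
    _ = ∑ r, expand R q (∑ j, c j * u j i r) * X ^ (r : ℕ) := by
        rw [Finset.sum_comm]
        simp [Finset.sum_mul]
    _ = 0 := by
        refine Finset.sum_eq_zero fun r _ => ?_
        have := congrFun hc (i, r)
        simp only [Finset.sum_apply, Pi.smul_apply, smul_eq_mul, Pi.zero_apply] at this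
        simp [this]

/-- A continuous function killed by a nonzero polynomial on an open set vanishes there. -/
theorem eq_zero_of_polynomial_mul_eq_zero {S : Set ℝ} (hS : IsOpen S) {φ : ℝ → ℝ}
    (hφ : ContinuousOn φ S) {G : Polynomial ℝ} (hG : G ≠ 0)
    (h0 : ∀ t ∈ S, G.eval t * φ t = 0) {t : ℝ} (ht : t ∈ S) : φ t = 0 := by
  by_contra hne
  have hSt : S ∈ nhds t := hS.mem_nhds ht
  have hev : ∀ᶠ s in nhds t, G.IsRoot s := by
    filter_upwards [hSt, (hφ.continuousAt hSt).eventually_ne hne] with s hs hs'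
    exact (mul_eq_zero.1 (h0 s hs)).resolve_right hs'
  exact hG (Polynomial.eq_zero_of_infinite_isRoot G (infinite_of_mem_nhds t hev))

theorem SimpleDE.mono {f : ℝ → ℝ} {m n : ℕ} {S : Set ℝ} (h : SimpleDE f m S) (hmn : m ≤ n) :
    SimpleDE f n S := by
  obtain ⟨p, ⟨k, hk, hpk⟩, hp⟩ := h
  refine ⟨fun i => if i ≤ m then p i else 0, ⟨k, hk.trans hmn, by simpa [hk] using hpk⟩,
    fun x hx => ?_⟩
  rw [← hp x hx]
  symm
  refine Finset.sum_subset_zero_on_sdiff (Finset.range_mono (by omega)) ?_ ?_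
  · intro i hi
    have : ¬ i ≤ m := by simp at hi; omega
    simp [this]
  · intro i hi
    have : i ≤ m := by simp at hi; omega
    simp [this]

/-- A simple differential equation may be rewritten with a nonzero leading coefficient. -/
theorem SimpleDE.exists_leadingCoeff_ne_zero {f : ℝ → ℝ} {n : ℕ} {S : Set ℝ}
    (h : SimpleDE f n S) :
    ∃ m ≤ n, ∃ p : ℕ → Polynomial ℝ, p m ≠ 0 ∧
      ∀ x ∈ S, ∑ k ∈ Finset.range (m + 1), (p k).eval x * iteratedDeriv k f x = 0 := by
  induction n with
  | zero =>
    obtain ⟨p, ⟨k, hk, hpk⟩, hp⟩ := h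
    obtain rfl : k = 0 := by omega
    exact ⟨0, le_rfl, p, hpk, hp⟩
  | succ n ih =>
    obtain ⟨p, ⟨k, hk, hpk⟩, hp⟩ := h
    by_cases hn : p (n + 1) = 0
    · have hkn : k ≠ n + 1 := by rintro rfl; exact hpk hn
      obtain ⟨m, hm, hmp⟩ := ih ⟨p, ⟨k, by omega, hpk⟩, fun x hx => by
        simpa [Finset.sum_range_succ _ (n + 1), hn] using hp x hx⟩
      exact ⟨m, by omega, hmp⟩
    · exact ⟨n + 1, le_rfl, p, hn, hp⟩

/-- Modulo a differential equation of order `m` with leading coefficient `p m`, the derivative of a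
polynomial combination of the derivatives of `f` of order less than `m`, multiplied by `p m`, is
again such a combination. -/
theorem exists_leadingCoeff_mul_deriv_eq {f : ℝ → ℝ} (hf : ContDiff ℝ (⊤ : ℕ∞) f) {S : Set ℝ}
    {m : ℕ} {p : ℕ → Polynomial ℝ}
    (hp : ∀ x ∈ S, ∑ k ∈ Finset.range (m + 1), (p k).eval x * iteratedDeriv k f x = 0)
    (v : ℕ → Polynomial ℝ) :
    ∃ w : ℕ → Polynomial ℝ, ∀ t ∈ S,
      (p m).eval t * deriv (fun s => ∑ i ∈ Finset.range m, (v i).eval s * iteratedDeriv i f s) t =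
        ∑ i ∈ Finset.range m, (w i).eval t * iteratedDeriv i f t := by
  have hderiv (t : ℝ) :
      deriv (fun s => ∑ i ∈ Finset.range m, (v i).eval s * iteratedDeriv i f s) t =
        ∑ i ∈ Finset.range m, ((v i).derivative.eval t * iteratedDeriv i f t +
          (v i).eval t * iteratedDeriv (i + 1) f t) := by
    refine (HasDerivAt.fun_sum fun i _ => ((v i).hasDerivAt t).mul ?_).deriv
    rw [iteratedDeriv_succ]
    exact (hf.differentiable_iteratedDeriv i (by exact_mod_cast WithTop.coe_lt_top i) t).hasDerivAt
  simp only [hderiv]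
  cases m with
  | zero => exact ⟨0, by simp⟩
  | succ k =>
    refine ⟨fun i => p (k + 1) * (v i).derivative +
      (if i = 0 then 0 else p (k + 1) * v (i - 1)) - v k * p i, fun t ht => ?_⟩
    have hpt := hp t ht
    rw [Finset.sum_range_succ] at hpt
    have hshift : ∑ i ∈ Finset.range (k + 1),
        (if i = 0 then 0 else p (k + 1) * v (i - 1)).eval t * iteratedDeriv i f t =
        (p (k + 1)).eval t * ∑ i ∈ Finset.range k, (v i).eval t * iteratedDeriv (i + 1) f t := by
      rw [Finset.sum_range_succ', Finset.mul_sum]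
      simp [mul_assoc]
    have hlow : ∑ i ∈ Finset.range (k + 1), (v k * p i).eval t * iteratedDeriv i f t =
        (v k).eval t *
          ∑ i ∈ Finset.range (k + 1), (p i).eval t * iteratedDeriv i f t := by
      rw [Finset.mul_sum]
      simp [mul_assoc]
    have hdiag : ∑ i ∈ Finset.range (k + 1),
        (p (k + 1) * (v i).derivative).eval t * iteratedDeriv i f t =
        (p (k + 1)).eval t *
          ∑ i ∈ Finset.range (k + 1), (v i).derivative.eval t * iteratedDeriv i f t := by
      rw [Finset.mul_sum]
      simp [mul_assoc]
    simp only [Polynomial.eval_sub, Polynomial.eval_add, sub_mul, add_mul, Finset.sum_add_distrib,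
      Finset.sum_sub_distrib, hshift, hlow, hdiag]
    rw [Finset.sum_range_succ fun i => (v i).eval t * iteratedDeriv (i + 1) f t]
    linear_combination (v k).eval t * hpt

/-- If `h (t ^ q) = f t` for `t > 0`, then each derivative of `h` at `t ^ q` is, up to a nonzero
polynomial factor, a polynomial combination of the derivatives of `f` of order less than `m`. -/
theorem exists_polynomial_mul_iteratedDeriv_pow_eq {f h : ℝ → ℝ} (hf : ContDiff ℝ (⊤ : ℕ∞) f)
    {m q : ℕ} (hq : 1 ≤ q) {p : ℕ → Polynomial ℝ} (hpm : p m ≠ 0)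
    (hp : ∀ x ∈ Set.Ioi (0 : ℝ),
      ∑ k ∈ Finset.range (m + 1), (p k).eval x * iteratedDeriv k f x = 0)
    (hh : ∀ t > 0, h (t ^ q) = f t)
    (hd : ∀ j : ℕ, ∀ x > 0, DifferentiableAt ℝ (iteratedDeriv j h) x) (j : ℕ) :
    ∃ g : Polynomial ℝ, g ≠ 0 ∧ ∃ v : ℕ → Polynomial ℝ, ∀ t > 0,
      g.eval t * iteratedDeriv j h (t ^ q) =
        ∑ i ∈ Finset.range m, (v i).eval t * iteratedDeriv i f t := by
  induction j with
  | zero =>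
    cases m with
    | zero =>
      refine ⟨p 0, hpm, 0, fun t ht => ?_⟩
      simpa [hh t ht] using hp t ht
    | succ k =>
      refine ⟨1, one_ne_zero, fun i => if i = 0 then 1 else 0, fun t ht => ?_⟩
      rw [Finset.sum_range_succ']
      simp [hh t ht]
  | succ j ih =>
    obtain ⟨g, hg, v, hv⟩ := ih
    obtain ⟨w, hw⟩ := exists_leadingCoeff_mul_deriv_eq hf hp v
    refine ⟨Polynomial.C (q : ℝ) * Polynomial.X ^ (q - 1) * g ^ 2 * p m, ?_,
      fun i => g * w i - p m * g.derivative * v i, fun t ht => ?_⟩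
    · have : q ≠ 0 := by omega
      simp [hg, hpm, this]
    · have hder : HasDerivAt (fun s => g.eval s * iteratedDeriv j h (s ^ q))
          (g.derivative.eval t * iteratedDeriv j h (t ^ q) +
            g.eval t * (iteratedDeriv (j + 1) h (t ^ q) * (q * t ^ (q - 1)))) t := by
        refine (g.hasDerivAt t).mul ?_
        rw [iteratedDeriv_succ]
        exact (hd j (t ^ q) (by positivity)).hasDerivAt.comp t (hasDerivAt_pow q t)
      have heq : (fun s => g.eval s * iteratedDeriv j h (s ^ q)) =ᶠ[nhds t]
          fun s => ∑ i ∈ Finset.range m, (v i).eval s * iteratedDeriv i f s := by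
        filter_upwards [Ioi_mem_nhds ht] with s hs using hv s hs
      have hwt := hw t ht
      rw [← heq.deriv_eq, hder.deriv] at hwt
      have hsum : ∑ i ∈ Finset.range m,
          (g * w i - p m * g.derivative * v i).eval t * iteratedDeriv i f t =
          g.eval t * ∑ i ∈ Finset.range m, (w i).eval t * iteratedDeriv i f t -
          (p m).eval t * g.derivative.eval t *
            ∑ i ∈ Finset.range m, (v i).eval t * iteratedDeriv i f t := by
        rw [Finset.mul_sum, Finset.mul_sum, ← Finset.sum_sub_distrib]
        refine Finset.sum_congr rfl fun i _ => ?_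
        simp only [Polynomial.eval_sub, Polynomial.eval_mul]
        ring
      rw [hsum, ← hwt, ← hv t ht]
      simp only [Polynomial.eval_mul, Polynomial.eval_pow, Polynomial.eval_C, Polynomial.eval_X]
      ring

theorem simpleDE_rpow_comp (f : ℝ → ℝ) (hf : ContDiff ℝ (⊤ : ℕ∞) f) (n : ℕ) (hn : 1 ≤ n)
    (hDE : SimpleDE f n (Set.Ioi 0)) (q : ℕ) (hq : 1 ≤ q)
    (h : ℝ → ℝ) (hh : ∀ x : ℝ, h x = f (x ^ (1 / (q : ℝ)))) :
    SimpleDE h (n * q) (Set.Ioi 0) := by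
  obtain ⟨m, hmn, p, hpm, hp⟩ := hDE.exists_leadingCoeff_ne_zero
  refine SimpleDE.mono (m := m * q) ?_ (Nat.mul_le_mul_right q hmn)
  have hq0 : q ≠ 0 := by omega
  have hpow : ∀ t > 0, h (t ^ q) = f t := fun t ht => by
    rw [hh, one_div, Real.pow_rpow_inv_natCast ht.le hq0]
  have hsmooth : ∀ x > 0, ContDiffAt ℝ (⊤ : ℕ∞) h x := fun x hx => by
    rw [show h = fun x => f (x ^ (1 / (q : ℝ))) from funext hh]
    exact hf.contDiffAt.comp x (Real.contDiffAt_rpow_const_of_ne hx.ne')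
  have hd : ∀ j : ℕ, ∀ x > 0, DifferentiableAt ℝ (iteratedDeriv j h) x := fun j x hx => by
    rw [iteratedDeriv_eq_equiv_comp, LinearIsometryEquiv.comp_differentiableAt_iff]
    exact ContDiffAt.differentiableAt_iteratedFDeriv (hsmooth x hx)
      (by exact_mod_cast WithTop.coe_lt_top j)
  choose g hg v hv using exists_polynomial_mul_iteratedDeriv_pow_eq hf hq hpm hp hpow hd
  obtain ⟨c, ⟨j₀, hj₀⟩, hc⟩ := exists_sum_expand_mul_eq_zero m hq
    fun (j : Fin (m * q + 1)) (i : Fin m) => (∏ l ∈ Finset.univ.erase j, g l) * v j i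
  refine ⟨fun j => if hj : j < m * q + 1 then c ⟨j, hj⟩ else 0,
    ⟨j₀, by omega, by simpa only [j₀.is_lt, dite_true] using hj₀⟩, fun x hx => ?_⟩
  rw [Finset.sum_range]
  simp only [Fin.is_lt, dite_true, Fin.eta]
  have hx0 : (0 : ℝ) < x := hx
  rw [← Real.rpow_inv_natCast_pow hx0.le hq0]
  refine eq_zero_of_polynomial_mul_eq_zero (G := ∏ l : Fin (m * q + 1), g l)
    (φ := fun t => ∑ j : Fin (m * q + 1), (c j).eval (t ^ q) * iteratedDeriv j h (t ^ q))
    isOpen_Ioi ?_ (Finset.prod_ne_zero_iff.2 fun l _ => hg l) ?_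
    (Set.mem_Ioi.2 (Real.rpow_pos_of_pos hx0 _))
  · refine continuousOn_finsetSum _ fun j _ => ContinuousOn.mul (by fun_prop) fun t ht => ?_
    have ht0 : (0 : ℝ) < t := ht
    exact ((hd j (t ^ q) (by positivity)).continuousAt.comp
      (f := fun s : ℝ => s ^ q) (by fun_prop)).continuousWithinAt
  · intro t ht
    calc (∏ l : Fin (m * q + 1), g l).eval t *
          ∑ j : Fin (m * q + 1), (c j).eval (t ^ q) * iteratedDeriv j h (t ^ q)
        = ∑ j : Fin (m * q + 1), ∑ i : Fin m,
            (Polynomial.expand ℝ q (c j) *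
              ((∏ l ∈ Finset.univ.erase j, g l) * v j i)).eval t * iteratedDeriv i f t := by
          rw [Finset.mul_sum]
          refine Finset.sum_congr rfl fun j _ => ?_
          have hvj := hv j t ht
          rw [Finset.sum_range] at hvj
          rw [← Finset.mul_prod_erase _ _ (Finset.mem_univ j)]
          simp only [Polynomial.eval_mul, Polynomial.expand_eval, mul_assoc, ← Finset.mul_sum]
          rw [← hvj]
          ring
      _ = ∑ i : Fin m, (∑ j, Polynomial.expand ℝ q (c j) *
              ((∏ l ∈ Finset.univ.erase j, g l) * v j i)).eval t * iteratedDeriv i f t := by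
          rw [Finset.sum_comm]
          simp only [Polynomial.eval_finsetSum, Finset.sum_mul]
      _ = 0 := by simp [hc]
end

section
/- Let f : ℝ → ℝ be smooth and suppose f satisfies a simple differential equation of order ≤ n on (0,∞) with n ≥ 1. Let p ∈ ℤ and q ∈ ℕ with q ≥ 1. Then the function h : ℝ → ℝ defined by h(x) = f(x^{p/q}) satisfies a simple differential equation of order ≤ n·q on (0,∞). -/
open Real Finset

open Polynomial in
/-- On `(0, ∞)`, `g` is a linear combination of the functions `F k` with coefficients in `ℝ(t)`. -/
def RatSpan {ι : Type*} [Fintype ι] (F : ι → ℝ → ℝ) (g : ℝ → ℝ) : Prop :=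
  ∃ D : ℝ[X], D ≠ 0 ∧ ∃ P : ι → ℝ[X], ∀ t > 0, D.eval t * g t = ∑ k, (P k).eval t * F k t

namespace RatSpan

open Polynomial

variable {ι : Type*} [Fintype ι] {F : ι → ℝ → ℝ} {g g' : ℝ → ℝ}

lemma congr (hg : RatSpan F g) (h : ∀ t > 0, g' t = g t) : RatSpan F g' := by
  obtain ⟨D, hD, P, hP⟩ := hg
  exact ⟨D, hD, P, fun t ht => by rw [h t ht, hP t ht]⟩

lemma zero : RatSpan F (fun _ => 0) :=
  ⟨1, one_ne_zero, fun _ => 0, fun t _ => by simp⟩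

lemma self (k : ι) : RatSpan F (F k) := by
  classical
  refine ⟨1, one_ne_zero, Pi.single k 1, fun t _ => ?_⟩
  rw [Finset.sum_eq_single k]
  · simp
  · intro b _ hb
    simp [Pi.single_eq_of_ne hb]
  · simp

lemma add (hg : RatSpan F g) (hg' : RatSpan F g') : RatSpan F (fun t => g t + g' t) := by
  obtain ⟨D, hD, P, hP⟩ := hg
  obtain ⟨D', hD', P', hP'⟩ := hg'
  refine ⟨D * D', mul_ne_zero hD hD', fun k => D' * P k + D * P' k, fun t ht => ?_⟩
  simp only [eval_add, eval_mul, add_mul, Finset.sum_add_distrib, mul_assoc, ← Finset.mul_sum,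
    ← hP t ht, ← hP' t ht]
  ring

lemma poly_mul (A : ℝ[X]) (hg : RatSpan F g) : RatSpan F (fun t => A.eval t * g t) := by
  obtain ⟨D, hD, P, hP⟩ := hg
  refine ⟨D, hD, fun k => A * P k, fun t ht => ?_⟩
  simp only [eval_mul, mul_assoc, ← Finset.mul_sum, ← hP t ht]
  ring

lemma of_poly_mul {A : ℝ[X]} (hA : A ≠ 0) (hg : RatSpan F (fun t => A.eval t * g t)) :
    RatSpan F g := by
  obtain ⟨D, hD, P, hP⟩ := hg
  refine ⟨D * A, mul_ne_zero hD hA, P, fun t ht => ?_⟩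
  rw [← hP t ht, eval_mul, mul_assoc]

lemma const_mul (c : ℝ) (hg : RatSpan F g) : RatSpan F (fun t => c * g t) :=
  (hg.poly_mul (C c)).congr fun t _ => by simp

lemma neg (hg : RatSpan F g) : RatSpan F (fun t => -g t) :=
  (hg.const_mul (-1)).congr fun t _ => by simp

lemma sum {κ : Type*} (s : Finset κ) {G : κ → ℝ → ℝ} (hG : ∀ i ∈ s, RatSpan F (G i)) :
    RatSpan F (fun t => ∑ i ∈ s, G i t) := by
  classical
  induction s using Finset.induction_on with
  | empty => simpa using zero
  | insert a s ha ih =>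
    refine ((hG a (by simp)).add (ih fun i hi => hG i (by simp [hi]))).congr fun t _ => ?_
    rw [Finset.sum_insert ha]

lemma zpow_mul (z : ℤ) (hg : RatSpan F g) : RatSpan F (fun t => t ^ z * g t) := by
  obtain ⟨s, rfl | rfl⟩ := z.eq_nat_or_neg
  · exact (hg.poly_mul (X ^ s)).congr fun t _ => by simp
  · refine of_poly_mul (A := X ^ s) (pow_ne_zero _ X_ne_zero) (hg.congr fun t ht => ?_)
    have : t ^ s ≠ 0 := (pow_pos ht s).ne'
    simp only [eval_pow, eval_X, zpow_neg, zpow_natCast]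
    field_simp

lemma hasDerivAt {F' : ι → ℝ → ℝ} (hF : ∀ k, ∀ t > 0, HasDerivAt (F k) (F' k t) t)
    (hF' : ∀ k, RatSpan F (F' k)) (hg : RatSpan F g) (hd : ∀ t > 0, HasDerivAt g (g' t) t) :
    RatSpan F g' := by
  have hg₀ := hg
  obtain ⟨D, hD, P, hP⟩ := hg
  refine of_poly_mul hD ?_
  refine ((sum Finset.univ fun k _ =>
    ((self k).poly_mul (derivative (P k))).add ((hF' k).poly_mul (P k))).add
      (hg₀.poly_mul (derivative D)).neg).congr fun t ht => ?_
  have h₁ := (D.hasDerivAt t).mul (hd t ht)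
  have h₂ : HasDerivAt (fun t => ∑ k, (P k).eval t * F k t)
      (∑ k, ((derivative (P k)).eval t * F k t + (P k).eval t * F' k t)) t :=
    HasDerivAt.fun_sum fun k _ => ((P k).hasDerivAt t).mul (hF k t ht)
  have h₃ := h₂.congr_of_eventuallyEq (f₁ := fun t => D.eval t * g t)
    (Filter.eventually_of_mem (Ioi_mem_nhds ht) hP)
  have := h₁.unique h₃
  linarith

/-- A polynomial in `t ^ p` is, up to a power of `t`, a polynomial in `t`. -/
lemma exists_pow_mul_eval_zpow {p : ℤ} (hp : p ≠ 0) (a : ℝ[X]) :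
    ∃ A : ℝ[X], ∃ M : ℕ, (a ≠ 0 → A ≠ 0) ∧ ∀ t > 0, t ^ M * a.eval (t ^ p) = A.eval t := by
  obtain ⟨s, rfl | rfl⟩ := p.eq_nat_or_neg
  · have hs : 0 < s := by omega
    exact ⟨expand ℝ s a, 0, (expand_ne_zero hs).2, fun t _ => by simp [expand_eval]⟩
  · have hs : 0 < s := by omega
    refine ⟨expand ℝ s a.reverse, s * a.natDegree, fun ha => (expand_ne_zero hs).2 ?_,
      fun t ht => ?_⟩
    · rwa [Ne, reverse_eq_zero]
    · have h0 : t ^ s ≠ 0 := (pow_pos ht s).ne'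
      let _ : Invertible (t ^ s)⁻¹ := invertibleOfNonzero (inv_ne_zero h0)
      have h := eval₂_reverse_mul_pow (RingHom.id ℝ) (t ^ s)⁻¹ a
      rw [invOf_eq_inv, inv_inv] at h
      simp only [eval₂_id] at h
      rw [expand_eval, zpow_neg, zpow_natCast, ← h, pow_mul, inv_pow]
      field_simp

lemma eval_zpow_mul {p : ℤ} (hp : p ≠ 0) (a : ℝ[X]) (hg : RatSpan F g) :
    RatSpan F (fun t => a.eval (t ^ p) * g t) := by
  obtain ⟨A, M, -, hA⟩ := exists_pow_mul_eval_zpow hp a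
  refine of_poly_mul (A := X ^ M) (pow_ne_zero _ X_ne_zero) ((hg.poly_mul A).congr fun t ht => ?_)
  rw [← hA t ht, eval_pow, eval_X, mul_assoc]

lemma of_eval_zpow_mul {p : ℤ} (hp : p ≠ 0) {a : ℝ[X]} (ha : a ≠ 0)
    (hg : RatSpan F (fun t => a.eval (t ^ p) * g t)) : RatSpan F g := by
  obtain ⟨A, M, hA₀, hA⟩ := exists_pow_mul_eval_zpow hp a
  refine of_poly_mul (hA₀ ha) ((hg.poly_mul (X ^ M)).congr fun t ht => ?_)
  rw [← hA t ht, eval_pow, eval_X, mul_assoc]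

end RatSpan

section PolynomialRelations

open Polynomial

lemma exists_eq_sum_X_pow_mul_expand {q : ℕ} (hq : 0 < q) (P : ℝ[X]) :
    ∃ c : Fin q → ℝ[X], P = ∑ i : Fin q, X ^ (i : ℕ) * expand ℝ q (c i) := by
  induction P using Polynomial.induction_on' with
  | add P Q hP hQ =>
    obtain ⟨c, hc⟩ := hP
    obtain ⟨d, hd⟩ := hQ
    refine ⟨fun i => c i + d i, ?_⟩
    simp only [map_add, mul_add, Finset.sum_add_distrib, ← hc, ← hd]
  | monomial n a =>
    refine ⟨Pi.single ⟨n % q, Nat.mod_lt _ hq⟩ (C a * X ^ (n / q)), ?_⟩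
    rw [Finset.sum_eq_single ⟨n % q, Nat.mod_lt _ hq⟩]
    · simp only [Pi.single_eq_same, map_mul, expand_C, map_pow, expand_X]
      rw [← C_mul_X_pow_eq_monomial, mul_left_comm, ← pow_mul, ← pow_add, Nat.mod_add_div]
    · intro b _ hb
      simp [Pi.single_eq_of_ne hb]
    · simp

/-- More than `q * card ι` vectors in `ℝ[X]^ι` are linearly dependent over `ℝ[X ^ q]`. -/
lemma exists_expand_relation {ι κ : Type*} [Fintype ι] [Fintype κ] {q : ℕ} (hq : 0 < q)
    (P : κ → ι → ℝ[X]) (hcard : Fintype.card ι * q < Fintype.card κ) :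
    ∃ c : κ → ℝ[X], (∃ j, c j ≠ 0) ∧ ∀ k, ∑ j, expand ℝ q (c j) * P j k = 0 := by
  choose d hd using exists_eq_sum_X_pow_mul_expand hq
  let v : κ → (ι × Fin q → ℝ[X]) := fun j ki => d (P j ki.1) ki.2
  have hv : ¬ LinearIndependent ℝ[X] v := fun h => by
    have := h.fintype_card_le_finrank
    simp only [Module.finrank_fintype_fun_eq_card, Fintype.card_prod, Fintype.card_fin] at this
    omega
  obtain ⟨c, hc, hc₀⟩ := Fintype.not_linearIndependent_iff.1 hv
  refine ⟨c, hc₀, fun k => ?_⟩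
  calc ∑ j, expand ℝ q (c j) * P j k
      = ∑ j, ∑ i : Fin q, X ^ (i : ℕ) * expand ℝ q (c j * v j (k, i)) := by
        refine Finset.sum_congr rfl fun j _ => ?_
        conv_lhs => rw [hd (P j k), Finset.mul_sum]
        refine Finset.sum_congr rfl fun i _ => ?_
        rw [map_mul]
        ring
    _ = ∑ i : Fin q, X ^ (i : ℕ) * expand ℝ q (∑ j, c j * v j (k, i)) := by
        rw [Finset.sum_comm]
        simp only [map_sum, Finset.mul_sum]
    _ = 0 := by
        refine Finset.sum_eq_zero fun i _ => ?_
        have := congrFun hc (k, i)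
        simp only [Finset.sum_apply, Pi.smul_apply, smul_eq_mul, Pi.zero_apply] at this
        rw [this, map_zero, mul_zero]

lemma exists_ne_zero_eval_pow_eq_zero {D : ℝ[X]} (hD : D ≠ 0) (q : ℕ) :
    ∃ E : ℝ[X], E ≠ 0 ∧ ∀ t, D.eval t = 0 → E.eval (t ^ q) = 0 := by
  refine ⟨∏ r ∈ D.roots.toFinset, (X - C (r ^ q)),
    Finset.prod_ne_zero_iff.2 fun r _ => X_sub_C_ne_zero _, fun t ht => ?_⟩
  rw [eval_prod]
  refine Finset.prod_eq_zero (i := t) ?_ (by simp)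
  simpa [hD] using ht

lemma RatSpan.exists_relation {ι κ : Type*} [Fintype ι] [Fintype κ] {q : ℕ} (hq : 0 < q)
    {F : ι → ℝ → ℝ} {G : κ → ℝ → ℝ} (hG : ∀ j, RatSpan F (G j))
    (hcard : Fintype.card ι * q < Fintype.card κ) :
    ∃ c : κ → ℝ[X], (∃ j, c j ≠ 0) ∧ ∀ t > 0, ∑ j, (c j).eval (t ^ q) * G j t = 0 := by
  classical
  choose D hD P hP using hG
  obtain ⟨c, ⟨j₀, hj₀⟩, hc⟩ := exists_expand_relation hq
    (fun j k => (∏ i ∈ Finset.univ.erase j, D i) * P j k) hcard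
  obtain ⟨E, hE, hE'⟩ := exists_ne_zero_eval_pow_eq_zero
    (Finset.prod_ne_zero_iff.2 fun j (_ : j ∈ Finset.univ) => hD j) q
  refine ⟨fun j => E * c j, ⟨j₀, mul_ne_zero hE hj₀⟩, fun t ht => ?_⟩
  by_cases h0 : (∏ j, D j).eval t = 0
  · simp [hE' t h0]
  have key : (∏ j, D j).eval t * ∑ j, (c j).eval (t ^ q) * G j t = 0 := by
    calc (∏ j, D j).eval t * ∑ j, (c j).eval (t ^ q) * G j t
        = ∑ j, ∑ k, (expand ℝ q (c j) *
            ((∏ i ∈ Finset.univ.erase j, D i) * P j k)).eval t * F k t := by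
          rw [Finset.mul_sum]
          refine Finset.sum_congr rfl fun j _ => ?_
          simp only [eval_mul, expand_eval, mul_assoc, ← Finset.mul_sum, ← hP j t ht]
          rw [← Finset.mul_prod_erase Finset.univ D (Finset.mem_univ j), eval_mul]
          ring
      _ = ∑ k, (∑ j, expand ℝ q (c j) *
            ((∏ i ∈ Finset.univ.erase j, D i) * P j k)).eval t * F k t := by
          rw [Finset.sum_comm]
          simp only [eval_finsetSum, Finset.sum_mul]
      _ = 0 := by simp [hc]
  simp only [eval_mul, mul_assoc, ← Finset.mul_sum]
  rw [(mul_eq_zero.1 key).resolve_left h0, mul_zero]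

end PolynomialRelations

lemma hasDerivAt_iteratedDeriv_of_contDiffOn {h : ℝ → ℝ} {s : Set ℝ} (hs : IsOpen s)
    (hh : ContDiffOn ℝ (⊤ : ℕ∞) h s) (j : ℕ) {x : ℝ} (hx : x ∈ s) :
    HasDerivAt (iteratedDeriv j h) (iteratedDeriv (j + 1) h x) x := by
  have h₁ := hh.differentiableOn_iteratedDerivWithin (m := j)
    (by exact_mod_cast WithTop.coe_lt_top (j : ℕ)) hs.uniqueDiffOn
  have h₂ : DifferentiableOn ℝ (iteratedDeriv j h) s :=
    h₁.congr fun y hy => (iteratedDerivWithin_of_isOpen hs hy).symm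
  rw [iteratedDeriv_succ]
  exact (h₂.differentiableAt (hs.mem_nhds hx)).hasDerivAt

/-- The leading equation expresses all derivatives of `f` along `t ↦ t ^ p` through the first
`m` of them. -/
lemma ratSpan_iteratedDeriv_comp_zpow {f : ℝ → ℝ} {m : ℕ} {a : ℕ → Polynomial ℝ} (ha : a m ≠ 0)
    (hDE : ∀ x ∈ Set.Ioi (0 : ℝ),
      ∑ k ∈ Finset.range (m + 1), (a k).eval x * iteratedDeriv k f x = 0)
    {p : ℤ} (hp : p ≠ 0) {k : ℕ} (hk : k ≤ m) :
    RatSpan (fun (i : Fin m) t => iteratedDeriv i f (t ^ p))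
      (fun t => iteratedDeriv k f (t ^ p)) := by
  have hlt : ∀ k < m, RatSpan (fun (i : Fin m) t => iteratedDeriv i f (t ^ p))
      (fun t => iteratedDeriv k f (t ^ p)) := fun k hk =>
    RatSpan.self (F := fun (i : Fin m) t => iteratedDeriv i f (t ^ p)) ⟨k, hk⟩
  rcases hk.lt_or_eq with hk | rfl
  · exact hlt k hk
  · refine RatSpan.of_eval_zpow_mul hp ha ((RatSpan.sum (Finset.range k) fun i hi =>
      (hlt i (Finset.mem_range.1 hi)).eval_zpow_mul hp (a i)).neg.congr fun t ht => ?_)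
    have := hDE (t ^ p) (zpow_pos ht p)
    rw [Finset.sum_range_succ] at this
    linarith

lemma SimpleDE.exists_leading {f : ℝ → ℝ} {n : ℕ} {S : Set ℝ} (h : SimpleDE f n S) :
    ∃ m ≤ n, ∃ a : ℕ → Polynomial ℝ, a m ≠ 0 ∧
      ∀ x ∈ S, ∑ k ∈ Finset.range (m + 1), (a k).eval x * iteratedDeriv k f x = 0 := by
  classical
  obtain ⟨a, ⟨k, hk, hak⟩, ha⟩ := h
  have hm : Nat.findGreatest (fun k => a k ≠ 0) n ≤ n := Nat.findGreatest_le n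
  refine ⟨Nat.findGreatest (fun k => a k ≠ 0) n, hm, a,
    Nat.findGreatest_spec (P := fun k => a k ≠ 0) hk hak, fun x hx => ?_⟩
  rw [← ha x hx]
  refine Finset.sum_subset (Finset.range_mono (by omega)) fun i hi hi' => ?_
  rw [Finset.mem_range] at hi hi'
  have := Nat.findGreatest_is_greatest (P := fun k => a k ≠ 0) (n := n) (k := i)
    (by omega) (by omega)
  rw [not_not.1 this]
  simp

lemma ratSpan_iteratedDeriv_comp_pow {ι : Type*} [Fintype ι] {F F' : ι → ℝ → ℝ}
    (hF : ∀ k, ∀ t > 0, HasDerivAt (F k) (F' k t) t) (hF' : ∀ k, RatSpan F (F' k))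
    {h : ℝ → ℝ} (hh : ContDiffOn ℝ (⊤ : ℕ∞) h (Set.Ioi 0)) {q : ℕ} (hq : 0 < q)
    (h₀ : RatSpan F (fun t => h (t ^ q))) (j : ℕ) :
    RatSpan F (fun t => iteratedDeriv j h (t ^ q)) := by
  induction j with
  | zero => simpa using h₀
  | succ j ih =>
    have hd : ∀ t > 0, HasDerivAt (fun t => iteratedDeriv j h (t ^ q))
        (iteratedDeriv (j + 1) h (t ^ q) * (q * t ^ (q - 1))) t := fun t ht =>
      (hasDerivAt_iteratedDeriv_of_contDiffOn isOpen_Ioi hh j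
        (Set.mem_Ioi.2 (pow_pos ht q))).comp t (hasDerivAt_pow q t)
    refine RatSpan.of_poly_mul (A := Polynomial.C (q : ℝ) * Polynomial.X ^ (q - 1)) ?_
      ((ih.hasDerivAt hF hF' hd).congr fun t _ => ?_)
    · exact mul_ne_zero (Polynomial.C_ne_zero.2 (by exact_mod_cast hq.ne'))
        (pow_ne_zero _ Polynomial.X_ne_zero)
    · simp only [Polynomial.eval_mul, Polynomial.eval_C, Polynomial.eval_pow, Polynomial.eval_X]
      ring

theorem simpleDE_rational_power_comp (f : ℝ → ℝ) (hf : ContDiff ℝ (⊤ : ℕ∞) f) (n : ℕ) (hn : 1 ≤ n)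
    (hDE : SimpleDE f n (Set.Ioi 0)) (p : ℤ) (q : ℕ) (hq : 1 ≤ q)
    (h : ℝ → ℝ) (hh : ∀ x : ℝ, h x = f (x ^ ((p : ℝ) / (q : ℝ)))) :
    SimpleDE h (n * q) (Set.Ioi 0) := by
  rcases eq_or_ne p 0 with rfl | hp
  · have hc : h = fun _ => f 1 := funext fun x => by simp [hh]
    refine ⟨Pi.single 1 1, ⟨1, Nat.mul_pos hn hq, by simp⟩, fun x _ => ?_⟩
    refine Finset.sum_eq_zero fun k _ => ?_
    rcases eq_or_ne k 1 with rfl | hk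
    · simp [hc]
    · simp [Pi.single_eq_of_ne hk]
  obtain ⟨m, hm, a, ha, hDE⟩ := hDE.exists_leading
  have hcont : ContDiffOn ℝ (⊤ : ℕ∞) h (Set.Ioi 0) := fun x hx => by
    rw [funext hh]
    exact (hf.contDiffAt.comp x
      (Real.contDiffAt_rpow_const_of_ne (ne_of_gt hx))).contDiffWithinAt
  have hpow : ∀ t > 0, h (t ^ q) = f (t ^ p) := fun t ht => by
    have hq' : (q : ℝ) ≠ 0 := by positivity
    rw [hh, ← Real.rpow_natCast, ← Real.rpow_mul ht.le, mul_div_cancel₀ _ hq', Real.rpow_intCast]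
  have hspan := fun {k : ℕ} => ratSpan_iteratedDeriv_comp_zpow ha hDE hp (k := k)
  have hF : ∀ k : Fin m, ∀ t > 0, HasDerivAt (fun t => iteratedDeriv k f (t ^ p))
      (p * (t ^ (p - 1) * iteratedDeriv (k + 1) f (t ^ p))) t := fun k t ht => by
    have h₁ := (hasDerivAt_iteratedDeriv_of_contDiffOn isOpen_univ hf.contDiffOn k
      (Set.mem_univ (t ^ p))).comp t (hasDerivAt_zpow p t (Or.inl ht.ne'))
    exact h₁.congr_deriv (by ring)
  have hG := ratSpan_iteratedDeriv_comp_pow hF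
    (fun k => ((hspan (by omega)).zpow_mul (p - 1)).const_mul p) hcont hq
    ((hspan (Nat.zero_le m)).congr fun t ht => by simp [hpow t ht])
  obtain ⟨c, ⟨j₀, hj₀⟩, hc⟩ := RatSpan.exists_relation (κ := Fin (n * q + 1)) hq
    (fun j => hG j) (by
      simp only [Fintype.card_fin]
      exact Nat.lt_succ_of_le (Nat.mul_le_mul_right q hm))
  refine ⟨fun j => if hj : j < n * q + 1 then c ⟨j, hj⟩ else 0,
    ⟨j₀, Nat.lt_succ_iff.1 j₀.2, by beta_reduce; rwa [dif_pos j₀.2]⟩, fun x hx => ?_⟩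
  have hx₀ : (0 : ℝ) < x := hx
  have hroot : (x ^ ((q : ℝ)⁻¹)) ^ q = x :=
    Real.rpow_inv_natCast_pow hx₀.le (by omega)
  have := hc _ (Real.rpow_pos_of_pos hx₀ (q : ℝ)⁻¹)
  rw [hroot] at this
  rw [Finset.sum_range, ← this]
  exact Finset.sum_congr rfl fun j _ => by beta_reduce; rw [dif_pos j.2]
end
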